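/- arXiv:1905.13484 — 2 statements merged into one kernel-verified Lean document; each statement's English description precedes it below -/
import Mathlib

section
/- For every infinite-dimensional real Banach space X there exists h : ℕ → X such that the ideal 𝓘^X_h = {A ⊆ ℕ : the family (h n)_{n∈A} is unconditionally convergent in X} is not a summable ideal: there is no f : ℕ → [0,∞) such that 𝓘^X_h = {A ⊆ ℕ : Σ_{n∈A} f n < ∞}. -/
open Module

theorem det_id_add_starProjection {V : Type*} [NormedAddCommGroup V] [InnerProductSpace ℝ V]
    [FiniteDimensional ℝ V] (W : Submodule ℝ V) :
    LinearMap.det ((LinearMap.id : V →ₗ[ℝ] V) + (W.starProjection : V →ₗ[ℝ] V)) =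
      2 ^ finrank ℝ W := by
  let e := W.prodEquivOfIsCompl _ W.isCompl_orthogonal
  have key : (LinearMap.id : V →ₗ[ℝ] V) + (W.starProjection : V →ₗ[ℝ] V) =
      (e : (W × Wᗮ) →ₗ[ℝ] V) ∘ₗ
        (LinearMap.prodMap ((2 : ℝ) • (LinearMap.id : W →ₗ[ℝ] W)) LinearMap.id) ∘ₗ
        (e.symm : V →ₗ[ℝ] W × Wᗮ) := by
    ext v
    obtain ⟨⟨x, y⟩, rfl⟩ := e.surjective v
    have hx : W.starProjection (x : V) = x := Submodule.starProjection_eq_self_iff.2 x.2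
    have hy : W.starProjection (y : V) = 0 :=
      (Submodule.starProjection_apply_eq_zero_iff W).2 y.2
    simp [e, hx, hy, two_smul]
    abel
  rw [key, LinearMap.det_conj, LinearMap.det_prodMap, LinearMap.det_smul, LinearMap.det_id,
    LinearMap.det_id]
  simp

/-- Among the maps `φ ∘ a` of norm at most one there is one of maximal determinant. -/
theorem exists_maximal_det {V X : Type*} [NormedAddCommGroup V] [NormedSpace ℝ V]
    [FiniteDimensional ℝ V] [NormedAddCommGroup X] [NormedSpace ℝ X] (φ : V →L[ℝ] X)
    (hφ : Function.Injective φ) :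
    ∃ a : V →L[ℝ] V, ‖φ ∘L a‖ ≤ 1 ∧ 0 < |a.det| ∧
      ∀ b : V →L[ℝ] V, ‖φ ∘L b‖ ≤ 1 → |b.det| ≤ |a.det| := by
  obtain ⟨C, -, hC⟩ := LinearMap.exists_antilipschitzWith (φ : V →ₗ[ℝ] X)
    (LinearMap.ker_eq_bot.2 hφ)
  have hbound : ∀ v, ‖v‖ ≤ C * ‖φ v‖ := fun v => by
    simpa using hC.le_mul_dist v 0
  let K : Set (V →L[ℝ] V) := {b | ‖φ ∘L b‖ ≤ 1}
  have hK : IsCompact K := by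
    refine Metric.isCompact_of_isClosed_isBounded ?_ ?_
    · exact isClosed_le (by fun_prop) continuous_const
    · refine (Metric.isBounded_closedBall (x := (0 : V →L[ℝ] V)) (r := C)).subset fun b hb => ?_
      rw [mem_closedBall_zero_iff]
      refine b.opNorm_le_bound C.2 fun v => (hbound _).trans ?_
      refine mul_le_mul_of_nonneg_left ?_ C.2
      simpa using (φ ∘L b).le_of_opNorm_le hb v
  obtain ⟨a, ha, hmax⟩ := hK.exists_isMaxOn ⟨0, by simp [K]⟩
    (continuous_abs.comp (ContinuousLinearMap.continuous_det (𝕜 := ℝ) (E := V))).continuousOn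
  refine ⟨a, ha, ?_, fun b hb => hmax hb⟩
  have hc : 0 < (‖φ‖ + 1)⁻¹ := by positivity
  have hmem : (‖φ‖ + 1)⁻¹ • ContinuousLinearMap.id ℝ V ∈ K := by
    change ‖φ ∘L ((‖φ‖ + 1)⁻¹ • ContinuousLinearMap.id ℝ V)‖ ≤ 1
    rw [ContinuousLinearMap.comp_smul, ContinuousLinearMap.comp_id, norm_smul,
      Real.norm_of_nonneg hc.le, inv_mul_le_iff₀ (by positivity)]
    linarith
  refine lt_of_lt_of_le ?_ (hmax hmem)
  have : ((‖φ‖ + 1)⁻¹ • ContinuousLinearMap.id ℝ V).det = (‖φ‖ + 1)⁻¹ ^ finrank ℝ V := by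
    change LinearMap.det ((‖φ‖ + 1)⁻¹ • (LinearMap.id : V →ₗ[ℝ] V)) = _
    rw [LinearMap.det_smul, LinearMap.det_id, mul_one]
  simp only [Function.comp_apply, this]
  positivity

/-- A map of maximal determinant is bounded below somewhere on every subspace of at least half
the dimension. -/
theorem exists_unit_lt_norm_of_maximal_det {V X : Type*} [NormedAddCommGroup V]
    [InnerProductSpace ℝ V] [FiniteDimensional ℝ V] [NormedAddCommGroup X] [NormedSpace ℝ X]
    (φ : V →L[ℝ] X) (a : V →L[ℝ] V) (ha : ‖φ ∘L a‖ ≤ 1) (hdet : 0 < |a.det|)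
    (hmax : ∀ b : V →L[ℝ] V, ‖φ ∘L b‖ ≤ 1 → |b.det| ≤ |a.det|)
    (W : Submodule ℝ V) (hW : 0 < finrank ℝ W) (hdim : finrank ℝ V ≤ 2 * finrank ℝ W) :
    ∃ y ∈ W, ‖y‖ = 1 ∧ 2 / 5 ≤ ‖φ (a y)‖ := by
  by_contra! hcon
  have hsmall : ∀ y ∈ W, ‖φ (a y)‖ ≤ 2 / 5 * ‖y‖ := by
    intro y hy
    rcases eq_or_ne y 0 with rfl | hy0
    · simp
    have hpos : 0 < ‖y‖ := norm_pos_iff.2 hy0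
    have := hcon (‖y‖⁻¹ • y) (W.smul_mem _ hy) (by
      rw [norm_smul, norm_inv, norm_norm, inv_mul_cancel₀ hpos.ne'])
    rw [map_smul, map_smul, norm_smul, norm_inv, norm_norm, inv_mul_lt_iff₀ hpos] at this
    linarith
  let T : V →L[ℝ] V := ContinuousLinearMap.id ℝ V + W.starProjection
  let b : V →L[ℝ] V := (5 / 7 : ℝ) • (a ∘L T)
  have hb : ‖φ ∘L b‖ ≤ 1 := by
    refine ContinuousLinearMap.opNorm_le_bound _ zero_le_one fun v => ?_
    have h1 : ‖φ (a v)‖ ≤ ‖v‖ := by simpa using (φ ∘L a).le_of_opNorm_le ha v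
    have h2 : ‖φ (a (W.starProjection v))‖ ≤ 2 / 5 * ‖v‖ :=
      (hsmall _ (W.starProjection_apply_mem v)).trans
        (mul_le_mul_of_nonneg_left (W.norm_starProjection_apply_le v) (by norm_num))
    have h3 : (φ ∘L b) v = (5 / 7 : ℝ) • (φ (a v) + φ (a (W.starProjection v))) := by
      simp [b, T]
    rw [h3, norm_smul, Real.norm_of_nonneg (by norm_num)]
    have := norm_add_le (φ (a v)) (φ (a (W.starProjection v)))
    linarith
  have hbdet : b.det = (5 / 7 : ℝ) ^ finrank ℝ V * (a.det * 2 ^ finrank ℝ W) := by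
    rw [← det_id_add_starProjection W]
    change LinearMap.det ((5 / 7 : ℝ) • ((a : V →ₗ[ℝ] V) ∘ₗ (T : V →ₗ[ℝ] V))) = _
    rw [LinearMap.det_smul, LinearMap.det_comp]
    rfl
  have hle := hmax b hb
  rw [hbdet, abs_mul, abs_mul, abs_of_pos (by positivity : (0 : ℝ) < (5 / 7) ^ finrank ℝ V),
    abs_of_pos (by positivity : (0 : ℝ) < 2 ^ finrank ℝ W)] at hle
  have h4 : (5 / 7 : ℝ) ^ (2 * finrank ℝ W) ≤ (5 / 7) ^ finrank ℝ V :=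
    pow_le_pow_of_le_one (by norm_num) (by norm_num) hdim
  have h5 : (1 : ℝ) < (5 / 7) ^ (2 * finrank ℝ W) * 2 ^ finrank ℝ W := by
    rw [pow_mul, ← mul_pow]
    exact one_lt_pow₀ (by norm_num) hW.ne'
  have h6 : (1 : ℝ) < (5 / 7) ^ finrank ℝ V * 2 ^ finrank ℝ W :=
    h5.trans_le (mul_le_mul_of_nonneg_right h4 (by positivity))
  nlinarith

theorem norm_sum_sq_eq_card {V : Type*} [NormedAddCommGroup V] [InnerProductSpace ℝ V]
    {ι : Type*} {y : ι → V} (hy : Orthonormal ℝ y) (t : Finset ι) :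
    ‖∑ i ∈ t, y i‖ ^ 2 = t.card := by
  have := hy.inner_sum (fun _ => 1) (fun _ => 1) t
  rw [← real_inner_self_eq_norm_sq]
  simpa using this

/-- A form of the Dvoretzky–Rogers lemma. -/
theorem exists_norm_ge_and_norm_sum_le {X : Type*} [NormedAddCommGroup X] [NormedSpace ℝ X]
    (hX : ¬ FiniteDimensional ℝ X) (k : ℕ) :
    ∃ x : Fin k → X, (∀ i, 2 / 5 ≤ ‖x i‖) ∧ ∀ t : Finset (Fin k), ‖∑ i ∈ t, x i‖ ≤ √k := by
  have hrank : ((2 * k : ℕ) : Cardinal) ≤ Module.rank ℝ X :=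
    Cardinal.natCast_lt_aleph0.le.trans (not_lt.1 fun h => hX (Module.rank_lt_aleph0_iff.1 h))
  obtain ⟨v, hv⟩ := exists_linearIndependent_of_le_rank hrank
  let V := EuclideanSpace ℝ (Fin (2 * k))
  have hV : finrank ℝ V = 2 * k := finrank_euclideanSpace_fin
  let ψ : V →ₗ[ℝ] X := Fintype.linearCombination ℝ v ∘ₗ (EuclideanSpace.equiv _ ℝ).toLinearMap
  have hψ : Function.Injective ψ :=
    (hv.fintypeLinearCombination_injective).comp (EuclideanSpace.equiv _ ℝ).injective
  let φ : V →L[ℝ] X := LinearMap.toContinuousLinearMap ψ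
  obtain ⟨a, ha, hdet, hmax⟩ := exists_maximal_det φ hψ
  have main : ∀ m ≤ k, ∃ y : Fin m → V, Orthonormal ℝ y ∧ ∀ i, 2 / 5 ≤ ‖φ (a (y i))‖ := by
    intro m
    induction m with
    | zero => exact fun _ => ⟨Fin.elim0, ⟨fun i => i.elim0, fun i => i.elim0⟩, fun i => i.elim0⟩
    | succ m ih =>
      intro hm
      obtain ⟨y, hy, hlow⟩ := ih (by omega)
      let W := Submodule.span ℝ (Set.range y)
      have h1 : finrank ℝ W = m := by
        simpa using finrank_span_eq_card hy.linearIndependent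
      have h2 := W.finrank_add_finrank_orthogonal
      obtain ⟨z, hz, hz1, hz2⟩ := exists_unit_lt_norm_of_maximal_det φ a ha hdet hmax Wᗮ
        (by omega) (by omega)
      have hyz : ∀ i, inner ℝ (y i) z = 0 := fun i =>
        (Submodule.mem_orthogonal W z).1 hz _ (Submodule.subset_span ⟨i, rfl⟩)
      refine ⟨Fin.cons z y, ⟨?_, ?_⟩, ?_⟩
      · intro i
        cases i using Fin.cases with
        | zero => simpa using hz1
        | succ i => simpa using hy.1 i
      · intro i j hij
        cases i using Fin.cases with
        | zero =>
          cases j using Fin.cases with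
          | zero => exact absurd rfl hij
          | succ j => simpa [real_inner_comm] using hyz j
        | succ i =>
          cases j using Fin.cases with
          | zero => simpa using hyz i
          | succ j => simpa using hy.2 (fun h => hij (congrArg Fin.succ h))
      · intro i
        cases i using Fin.cases with
        | zero => simpa using hz2
        | succ i => simpa using hlow i
  obtain ⟨y, hy, hlow⟩ := main k le_rfl
  refine ⟨fun i => φ (a (y i)), hlow, fun t => ?_⟩
  have h1 : ∑ i ∈ t, φ (a (y i)) = (φ ∘L a) (∑ i ∈ t, y i) := by simp
  have h2 : ‖∑ i ∈ t, y i‖ ≤ √k := by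
    refine Real.le_sqrt_of_sq_le ?_
    rw [norm_sum_sq_eq_card hy]
    exact_mod_cast card_finset_fin_le t
  rw [h1]
  exact ((φ ∘L a).le_of_opNorm_le ha _).trans (by simpa using h2)

/-- A family split into finite blocks is summable if the partial sums inside the blocks have
summable bounds. -/
theorem summable_sigma_of_norm_sum_le {X : Type*} [NormedAddCommGroup X] [CompleteSpace X]
    {α : Type*} {β : α → Type*} [∀ j, Fintype (β j)] {z : (Σ j, β j) → X} {c : α → ℝ}
    (hc : Summable c) (hz : ∀ j (t : Finset (β j)), ‖∑ i ∈ t, z ⟨j, i⟩‖ ≤ c j) : Summable z := by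
  classical
  rw [summable_iff_vanishing_norm]
  intro ε hε
  obtain ⟨s, hs⟩ := summable_iff_vanishing_norm.1 hc ε hε
  refine ⟨s.sigma fun _ => Finset.univ, fun t ht => ?_⟩
  have hsplit : ∑ p ∈ t, z p = ∑ j ∈ t.image Sigma.fst,
      ∑ i ∈ t.preimage (Sigma.mk j) sigma_mk_injective.injOn, z ⟨j, i⟩ := by
    rw [Finset.sum_sigma']
    refine Finset.sum_congr ?_ fun _ _ => rfl
    ext ⟨j, i⟩
    simp only [Finset.mem_sigma, Finset.mem_image, Finset.mem_preimage]
    exact ⟨fun h => ⟨⟨_, h, rfl⟩, h⟩, fun h => h.2⟩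
  have hdisj : Disjoint (t.image Sigma.fst) s := by
    rw [Finset.disjoint_left]
    intro j hj hjs
    obtain ⟨p, hp, rfl⟩ := Finset.mem_image.1 hj
    exact Finset.disjoint_left.1 ht hp (by simpa using hjs)
  rw [hsplit]
  calc _ ≤ ∑ j ∈ t.image Sigma.fst, c j := norm_sum_le_of_le _ fun j _ => hz j _
    _ ≤ ‖∑ j ∈ t.image Sigma.fst, c j‖ := le_abs_self _
    _ < ε := hs _ hdisj

theorem stmt2
    (X : Type*) [NormedAddCommGroup X] [NormedSpace ℝ X] [CompleteSpace X]
    (hX : ¬ FiniteDimensional ℝ X) :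
    ∃ h : ℕ → X,
      ¬ ∃ f : ℕ → ℝ, (∀ n, 0 ≤ f n) ∧
        ∀ A : Set ℕ, (Summable fun n : A => h n) ↔ (Summable fun n : A => f n) := by
  choose x hlow hsum using fun j : ℕ => exists_norm_ge_and_norm_sum_le hX (4 ^ j)
  obtain ⟨hι⟩ := nonempty_denumerable (Σ j : ℕ, Fin (4 ^ j) × Fin (4 ^ j))
  let e := Denumerable.eqv (Σ j : ℕ, Fin (4 ^ j) × Fin (4 ^ j))
  let H : (Σ j : ℕ, Fin (4 ^ j) × Fin (4 ^ j)) → X := fun p => ((4 : ℝ) ^ p.1)⁻¹ • x p.1 p.2.1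
  refine ⟨H ∘ e.symm, ?_⟩
  rintro ⟨f, hf, hiff⟩
  have transfer : ∀ g : (Σ j : ℕ, Fin (4 ^ j)) → (Σ j : ℕ, Fin (4 ^ j) × Fin (4 ^ j)),
      Function.Injective g → (Summable (H ∘ g) ↔ Summable (f ∘ e ∘ g)) := by
    intro g hg
    have := hiff (Set.range (e ∘ g))
    rw [← (Equiv.ofInjective _ (e.injective.comp hg)).summable_iff,
      ← (Equiv.ofInjective _ (e.injective.comp hg)).summable_iff] at this
    simpa [Function.comp_def] using this
  have : ∀ j, Nonempty (Fin (4 ^ j)) := fun j => ⟨⟨0, by positivity⟩⟩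
  -- In each block pick, for every vector, the copy of largest weight.
  choose l hl using fun (j : ℕ) (i : Fin (4 ^ j)) =>
    Finite.exists_max fun l : Fin (4 ^ j) => f (e ⟨j, i, l⟩)
  have hsel : Summable (H ∘ fun p : Σ j : ℕ, Fin (4 ^ j) =>
      (⟨p.1, p.2, l p.1 p.2⟩ : Σ j : ℕ, Fin (4 ^ j) × Fin (4 ^ j))) := by
    refine summable_sigma_of_norm_sum_le (c := fun j => (1 / 2 : ℝ) ^ j)
      (summable_geometric_of_lt_one (by norm_num) (by norm_num)) fun j t => ?_
    simp only [Function.comp_apply, H]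
    rw [← Finset.smul_sum, norm_smul, norm_inv, Real.norm_of_nonneg (by positivity),
      inv_mul_le_iff₀ (by positivity), ← mul_pow]
    refine (hsum j t).trans ?_
    have : ((4 ^ j : ℕ) : ℝ) = (2 ^ j) ^ 2 := by
      rw [← pow_mul, mul_comm, pow_mul]; norm_num
    rw [this, Real.sqrt_sq (by positivity)]
    norm_num
  rw [transfer _ (by rintro ⟨j, i⟩ ⟨j', i'⟩ h; grind)] at hsel
  have hblock := ((summable_sigma_of_nonneg fun p => hf _).1 hsel).2
  simp only [tsum_fintype, Function.comp_apply] at hblock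
  -- In each block pick the vector whose largest weight is smallest, and take all its copies.
  choose i hi using fun j : ℕ =>
    Finite.exists_min fun i : Fin (4 ^ j) => f (e ⟨j, i, l j i⟩)
  have hcopies : Summable (f ∘ e ∘ fun p : Σ j : ℕ, Fin (4 ^ j) =>
      (⟨p.1, i p.1, p.2⟩ : Σ j : ℕ, Fin (4 ^ j) × Fin (4 ^ j))) := by
    refine (summable_sigma_of_nonneg fun p => hf _).2 ⟨fun j => Summable.of_finite, ?_⟩
    simp only [tsum_fintype, Function.comp_apply]
    refine hblock.of_nonneg_of_le (fun j => Finset.sum_nonneg fun _ _ => hf _) fun j => ?_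
    exact Finset.sum_le_sum fun q _ => (hl j (i j) q).trans (hi j q)
  rw [← transfer _ (by rintro ⟨j, i⟩ ⟨j', i'⟩ h; grind)] at hcopies
  have hlim := hcopies.sigma.tendsto_atTop_zero
  obtain ⟨N, hN⟩ := (Metric.tendsto_atTop.1 hlim) (2 / 5) (by norm_num)
  have hlt := hN N le_rfl
  simp only [tsum_fintype, Function.comp_apply, H, Finset.sum_const, Finset.card_univ,
    Fintype.card_fin, dist_zero_right] at hlt
  rw [← Nat.cast_smul_eq_nsmul ℝ, smul_smul, Nat.cast_pow, Nat.cast_ofNat,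
    mul_inv_cancel₀ (by positivity), one_smul] at hlt
  exact absurd (hlow N (i N)) (not_le.2 hlt)
end

section
/- Let X be a real Banach space. Then X contains no isomorphic copy of c₀ (there is no continuous linear map T : c₀ → X and constant c > 0 with ‖T x‖ ≥ c‖x‖ for all x ∈ c₀) if and only if for every h : ℕ → X the ideal 𝓘^X_h = {A ⊆ ℕ : the family (h n)_{n∈A} is unconditionally convergent in X} is F_σ. -/
open Filter Topology ZeroAtInfty

open Classical in
/-- The characteristic function of a set of naturals, as an element of the Cantor space. -/
noncomputable def chi (A : Set ℕ) : ℕ → Bool := fun n => decide (n ∈ A)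

/-- A set in the Cantor space is F_σ if it is a countable union of closed sets. -/
def IsFsigma (S : Set (ℕ → Bool)) : Prop :=
  ∃ C : ℕ → Set (ℕ → Bool), (∀ n, IsClosed (C n)) ∧ S = ⋃ n, C n

/-- The signed estimate: if all finite partial sums of `z` are bounded by `M`, then the finite sums
of `|f (z i)|` are bounded by `2 * M` for every functional `f` in the dual unit ball. -/
lemma sum_abs_dual_le {X ι : Type*} [NormedAddCommGroup X] [NormedSpace ℝ X] {z : ι → X} {M : ℝ}
    (hz : ∀ F : Finset ι, ‖∑ i ∈ F, z i‖ ≤ M) {f : StrongDual ℝ X} (hf : ‖f‖ ≤ 1)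
    (F : Finset ι) : ∑ i ∈ F, |f (z i)| ≤ 2 * M := by
  have key : ∀ G : Finset ι, |∑ i ∈ G, f (z i)| ≤ M := fun G => by
    rw [← map_sum, ← Real.norm_eq_abs]
    exact (f.le_of_opNorm_le hf _).trans (by simpa using hz G)
  rw [← Finset.sum_filter_add_sum_filter_not F (fun i => 0 ≤ f (z i))]
  have h1 : ∑ i ∈ F with 0 ≤ f (z i), |f (z i)| = ∑ i ∈ F with 0 ≤ f (z i), f (z i) :=
    Finset.sum_congr rfl fun i hi => abs_of_nonneg (Finset.mem_filter.1 hi).2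
  have h2 : ∑ i ∈ F with ¬ 0 ≤ f (z i), |f (z i)| = -∑ i ∈ F with ¬ 0 ≤ f (z i), f (z i) := by
    rw [← Finset.sum_neg_distrib]
    exact Finset.sum_congr rfl fun i hi => abs_of_neg (not_le.1 (Finset.mem_filter.1 hi).2)
  rw [h1, h2]
  linarith [(abs_le.1 (key {i ∈ F | 0 ≤ f (z i)})).2, (abs_le.1 (key {i ∈ F | ¬ 0 ≤ f (z i)})).1]

lemma norm_sum_smul_le {X ι : Type*} [NormedAddCommGroup X] [NormedSpace ℝ X] {z : ι → X} {M : ℝ}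
    (hz : ∀ F : Finset ι, ‖∑ i ∈ F, z i‖ ≤ M) {a : ι → ℝ} {δ : ℝ} (hδ : 0 ≤ δ) (F : Finset ι)
    (ha : ∀ i ∈ F, |a i| ≤ δ) : ‖∑ i ∈ F, a i • z i‖ ≤ δ * (2 * M) := by
  obtain ⟨f, hf, hfx⟩ := exists_dual_vector'' ℝ (∑ i ∈ F, a i • z i)
  calc ‖∑ i ∈ F, a i • z i‖ = ∑ i ∈ F, a i * f (z i) := by
        simpa [map_sum] using hfx.symm
    _ ≤ ∑ i ∈ F, δ * |f (z i)| := Finset.sum_le_sum fun i hi => by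
        refine (le_abs_self _).trans ?_
        rw [abs_mul]
        exact mul_le_mul_of_nonneg_right (ha i hi) (abs_nonneg _)
    _ = δ * ∑ i ∈ F, |f (z i)| := by rw [Finset.mul_sum]
    _ ≤ δ * (2 * M) := mul_le_mul_of_nonneg_left (sum_abs_dual_le hz hf F) hδ

lemma summable_smul_of_tendsto_zero {X ι : Type*} [NormedAddCommGroup X] [NormedSpace ℝ X]
    [CompleteSpace X] {z : ι → X} {M : ℝ} (hz : ∀ F : Finset ι, ‖∑ i ∈ F, z i‖ ≤ M) {a : ι → ℝ}
    (ha : Tendsto a cofinite (𝓝 0)) : Summable fun i => a i • z i := by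
  have hM : 0 ≤ M := (norm_nonneg _).trans (hz ∅)
  rw [summable_iff_vanishing_norm]
  intro ε hε
  have hδ : 0 < ε / (2 * M + 1) := by positivity
  have hfin : {i | ¬ |a i| < ε / (2 * M + 1)}.Finite := by
    have := (Metric.tendsto_nhds.1 ha) _ hδ
    simpa [eventually_cofinite] using this
  refine ⟨hfin.toFinset, fun t ht => ?_⟩
  refine (norm_sum_smul_le hz hδ.le t fun i hi => ?_).trans_lt ?_
  · by_contra h
    exact Finset.disjoint_left.1 ht hi (hfin.mem_toFinset.2 fun h' => h h'.le)
  · rw [div_mul_eq_mul_div, div_lt_iff₀ (by positivity)]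
    nlinarith

lemma Summable.exists_norm_sum_le {X ι : Type*} [NormedAddCommGroup X] {z : ι → X}
    (hz : Summable z) : ∃ M : ℝ, ∀ F : Finset ι, ‖∑ i ∈ F, z i‖ ≤ M := by
  classical
  obtain ⟨s, hs⟩ := cauchySeq_finset_iff_vanishing_norm.1 hz.hasSum.cauchySeq 1 one_pos
  refine ⟨∑ i ∈ s, ‖z i‖ + 1, fun F => ?_⟩
  rw [← Finset.sum_inter_add_sum_sdiff F s]
  refine (norm_add_le _ _).trans (add_le_add ?_ (hs _ Finset.sdiff_disjoint).le)
  exact (norm_sum_le _ _).trans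
    (Finset.sum_le_sum_of_subset_of_nonneg Finset.inter_subset_right fun _ _ _ => norm_nonneg _)

/-- Rosenthal's lemma: a nonnegative matrix with uniformly bounded off-diagonal row sums has an
infinite principal submatrix with small off-diagonal row sums. -/
lemma exists_injective_offDiag_sum_le {ε : ℝ} (hε : 0 ≤ ε) (n : ℕ) (m : ℕ → ℕ → ℝ)
    (hm : ∀ k j, 0 ≤ m k j) (hn : ∀ k, ∀ F : Finset ℕ, k ∉ F → ∑ j ∈ F, m k j ≤ n * ε) :
    ∃ φ : ℕ → ℕ, Function.Injective φ ∧
      ∀ k, ∀ F : Finset ℕ, k ∉ F → ∑ j ∈ F, m (φ k) (φ j) ≤ ε := by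
  classical
  induction n generalizing m with
  | zero => exact ⟨id, Function.injective_id, fun k F hk => (hn k F hk).trans (by simpa using hε)⟩
  | succ n ih =>
    by_cases hp : ∃ p : ℕ, ∀ i, ∀ F : Finset ℕ, i ∉ F →
        ∑ j ∈ F, m (Nat.pair p i) (Nat.pair p j) ≤ ε
    · obtain ⟨p, hp⟩ := hp
      exact ⟨Nat.pair p, fun i j hij => (Nat.pair_eq_pair.1 hij).2, hp⟩
    · push Not at hp
      choose i F hiF hF using hp
      have hinj : Function.Injective fun p => Nat.pair p (i p) :=
        fun p q hpq => (Nat.pair_eq_pair.1 hpq).1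
      obtain ⟨φ, hφ, h⟩ := ih (fun p q => m (Nat.pair p (i p)) (Nat.pair q (i q)))
        (fun _ _ => hm _ _) (fun p G hpG => by
          have hdisj : Disjoint (G.image fun q => Nat.pair q (i q))
              ((F p).image fun j => Nat.pair p j) := by
            rw [Finset.disjoint_left]
            intro x hx hx'
            obtain ⟨q, hq, rfl⟩ := Finset.mem_image.1 hx
            obtain ⟨j, -, hj⟩ := Finset.mem_image.1 hx'
            exact hpG ((Nat.pair_eq_pair.1 hj).1 ▸ hq)
          have := hn (Nat.pair p (i p)) (G.image (fun q => Nat.pair q (i q)) ∪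
            (F p).image fun j => Nat.pair p j) (by
              simp only [Finset.mem_union, Finset.mem_image, not_or, not_exists, not_and]
              refine ⟨fun q hq h => hpG ((Nat.pair_eq_pair.1 h).1 ▸ hq), fun j hj h => ?_⟩
              exact hiF p ((Nat.pair_eq_pair.1 h).2 ▸ hj))
          rw [Finset.sum_union hdisj, Finset.sum_image hinj.injOn,
            Finset.sum_image (fun a _ b _ h => (Nat.pair_eq_pair.1 h).2)] at this
          have h2 := hF p
          push_cast at this
          linarith)
      exact ⟨_, hinj.comp hφ, h⟩

/-- A non-summable family with bounded finite partial sums has a sequence of blocks that is bounded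
away from zero and still has bounded finite partial sums. -/
lemma exists_blocks_of_not_summable {X ι : Type*} [NormedAddCommGroup X] [CompleteSpace X]
    {z : ι → X} {M : ℝ} (hz : ∀ F : Finset ι, ‖∑ i ∈ F, z i‖ ≤ M) (hns : ¬ Summable z) :
    ∃ ε > 0, ∃ y : ℕ → X, (∀ k, ε ≤ ‖y k‖) ∧ ∀ F : Finset ℕ, ‖∑ k ∈ F, y k‖ ≤ M := by
  classical
  rw [summable_iff_vanishing_norm] at hns
  push Not at hns
  obtain ⟨ε, hε, h⟩ := hns
  choose t ht htε using h
  let s : ℕ → Finset ι := fun k => Nat.rec ∅ (fun _ u => u ∪ t u) k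
  have hs : ∀ k, s (k + 1) = s k ∪ t (s k) := fun _ => rfl
  have hmono : Monotone s := monotone_nat_of_le_succ fun k => by
    rw [hs]; exact Finset.subset_union_left
  have hdisj : Pairwise fun j k => Disjoint (t (s j)) (t (s k)) := by
    refine (pairwise_disjoint_on _).2 fun j k hjk => ?_
    refine ((ht (s k)).mono_right ?_).symm
    refine Finset.Subset.trans ?_ (hmono (Nat.succ_le_of_lt hjk))
    rw [Nat.succ_eq_add_one, hs]; exact Finset.subset_union_right
  refine ⟨ε, hε, fun k => ∑ i ∈ t (s k), z i, fun k => htε _, fun F => ?_⟩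
  rw [← Finset.sum_biUnion (fun j _ k _ hjk => hdisj hjk)]
  exact hz _

lemma ZeroAtInftyContinuousMap.norm_apply_le (a : C₀(ℕ, ℝ)) (k : ℕ) : |a k| ≤ ‖a‖ :=
  a.toBCF.norm_coe_le_norm k

lemma ZeroAtInftyContinuousMap.norm_le_of_forall {a : C₀(ℕ, ℝ)} {C : ℝ} (hC : 0 ≤ C)
    (h : ∀ k, |a k| ≤ C) : ‖a‖ ≤ C :=
  (BoundedContinuousFunction.norm_le (f := a.toBCF) hC).2 h

/-- A sequence with bounded finite partial sums that is bounded away from zero spans, along a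
subsequence, an isomorphic copy of `c₀`. -/
lemma exists_c0_embedding_of_bounded_sums {X : Type*} [NormedAddCommGroup X] [NormedSpace ℝ X]
    [CompleteSpace X] {y : ℕ → X} {M ε : ℝ} (hε : 0 < ε) (hy : ∀ k, ε ≤ ‖y k‖)
    (hM : ∀ F : Finset ℕ, ‖∑ k ∈ F, y k‖ ≤ M) :
    ∃ (T : C₀(ℕ, ℝ) →L[ℝ] X) (c : ℝ), 0 < c ∧ ∀ x : C₀(ℕ, ℝ), c * ‖x‖ ≤ ‖T x‖ := by
  classical
  choose f hf hfy using fun k => exists_dual_vector'' ℝ (y k)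
  obtain ⟨n, hn⟩ := exists_nat_ge (2 * M / (ε / 2))
  obtain ⟨φ, hφ, hφs⟩ := exists_injective_offDiag_sum_le (half_pos hε).le n
    (fun k j => |f k (y j)|) (fun _ _ => abs_nonneg _) fun k F _ =>
      (sum_abs_dual_le hM (hf k) F).trans ((div_le_iff₀ (half_pos hε)).1 hn)
  have hz : ∀ F : Finset ℕ, ‖∑ k ∈ F, y (φ k)‖ ≤ M := fun F => by
    rw [← Finset.sum_image (f := y) hφ.injOn]
    exact hM _
  have hsum : ∀ a : C₀(ℕ, ℝ), Summable fun k => a k • y (φ k) := fun a =>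
    summable_smul_of_tendsto_zero hz (by
      rw [← cocompact_eq_cofinite]; exact a.zero_at_infty')
  let L : C₀(ℕ, ℝ) →ₗ[ℝ] X :=
    { toFun := fun a => ∑' k, a k • y (φ k)
      map_add' := fun a b => by
        rw [← (hsum a).tsum_add (hsum b)]
        simp [add_smul]
      map_smul' := fun r a => by
        rw [RingHom.id_apply, ← (hsum a).tsum_const_smul r]
        simp [mul_smul] }
  have hL : ∀ a, Tendsto (fun F : Finset ℕ => ‖∑ k ∈ F, a k • y (φ k)‖) atTop (𝓝 ‖L a‖) :=
    fun a => (hsum a).hasSum.norm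
  refine ⟨L.mkContinuous (2 * M) fun a => ?_, ε / 2, half_pos hε, fun a => ?_⟩
  · refine le_of_tendsto' (hL a) fun F => ?_
    rw [mul_comm]
    exact norm_sum_smul_le hz (norm_nonneg a) F fun k _ => a.norm_apply_le k
  · have hk : ∀ k, |a k| * ε - ‖a‖ * (ε / 2) ≤ ‖L a‖ := fun k => by
      refine ge_of_tendsto (hL a) ?_
      filter_upwards [eventually_ge_atTop {k}] with F hF
      have hkF : k ∈ F := Finset.singleton_subset_iff.1 hF
      have h1 : |f (φ k) (∑ j ∈ F, a j • y (φ j))| ≤ ‖∑ j ∈ F, a j • y (φ j)‖ := by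
        simpa using (f (φ k)).le_of_opNorm_le (hf (φ k)) (∑ j ∈ F, a j • y (φ j))
      have h2 : f (φ k) (∑ j ∈ F, a j • y (φ j)) =
          a k * ‖y (φ k)‖ + ∑ j ∈ F.erase k, a j * f (φ k) (y (φ j)) := by
        rw [map_sum, ← Finset.add_sum_erase _ _ hkF]
        simp [hfy]
      have h3 : |∑ j ∈ F.erase k, a j * f (φ k) (y (φ j))| ≤ ‖a‖ * (ε / 2) := by
        refine (Finset.abs_sum_le_sum_abs _ _).trans ?_
        refine le_trans (Finset.sum_le_sum fun j _ => ?_)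
          (le_of_eq_of_le (Finset.mul_sum _ _ _).symm
            (mul_le_mul_of_nonneg_left (hφs k (F.erase k) (Finset.notMem_erase k F))
              (norm_nonneg a)))
        rw [abs_mul]
        exact mul_le_mul_of_nonneg_right (a.norm_apply_le j) (abs_nonneg _)
      have h4 : |a k| * ε ≤ |a k * ‖y (φ k)‖| := by
        rw [abs_mul, abs_norm]
        exact mul_le_mul_of_nonneg_left (hy _) (abs_nonneg _)
      rw [h2] at h1
      have h5 := abs_sub_abs_le_abs_add (a k * ‖y (φ k)‖)
        (∑ j ∈ F.erase k, a j * f (φ k) (y (φ j)))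
      linarith
    have hnorm : ‖a‖ ≤ (‖L a‖ + ‖a‖ * (ε / 2)) / ε :=
      ZeroAtInftyContinuousMap.norm_le_of_forall (by positivity) fun k => by
        rw [le_div_iff₀ hε]
        linarith [hk k]
    rw [le_div_iff₀ hε] at hnorm
    change ε / 2 * ‖a‖ ≤ ‖L a‖
    linarith

lemma chi_apply_eq_true {A : Set ℕ} {n : ℕ} : chi A n = true ↔ n ∈ A := by
  simp [chi]

lemma chi_injective : Function.Injective chi := fun A B h => by
  ext n
  rw [← chi_apply_eq_true, h, chi_apply_eq_true]

lemma chi_setOf (x : ℕ → Bool) : chi {n | x n = true} = x := by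
  ext n
  simp [chi]

lemma isClosed_setOf_norm_sum_le {X : Type*} [NormedAddCommGroup X] (h : ℕ → X) (M : ℝ) :
    IsClosed {x : ℕ → Bool |
      ∀ F : Finset ℕ, (∀ n ∈ F, x n = true) → ‖∑ n ∈ F, h n‖ ≤ M} := by
  simp only [Set.ofPred_forall]
  refine isClosed_iInter fun F => ?_
  by_cases hF : ‖∑ n ∈ F, h n‖ ≤ M
  · simp [hF]
  · simp only [hF, imp_false]
    have : {x : ℕ → Bool | ¬ ∀ n ∈ F, x n = true} = ⋃ n ∈ F, {x | x n = false} := by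
      ext x; simp
    rw [this]
    exact isClosed_biUnion_finset fun n _ => isClosed_eq (continuous_apply n) continuous_const

lemma isFsigma_of_forall_summable {X : Type*} [NormedAddCommGroup X] {h : ℕ → X}
    (hs : ∀ A : Set ℕ, (∃ M : ℝ, ∀ F : Finset A, ‖∑ n ∈ F, h n‖ ≤ M) →
      Summable fun n : A => h n) :
    IsFsigma (chi '' {A : Set ℕ | Summable fun n : A => h n}) := by
  classical
  refine ⟨_, fun M : ℕ => isClosed_setOf_norm_sum_le h M, ?_⟩
  ext x
  simp only [Set.mem_image, Set.mem_ofPred_eq, Set.mem_iUnion]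
  constructor
  · rintro ⟨A, hA, rfl⟩
    obtain ⟨M, hM⟩ := hA.exists_norm_sum_le
    obtain ⟨N, hN⟩ := exists_nat_ge M
    refine ⟨N, fun F hF => ?_⟩
    have := hM (F.subtype (· ∈ A))
    rw [Finset.sum_subtype_of_mem h fun n hn => chi_apply_eq_true.1 (hF n hn)] at this
    exact this.trans hN
  · rintro ⟨M, hM⟩
    refine ⟨{n | x n = true}, hs _ ⟨M, fun F => ?_⟩, chi_setOf x⟩
    have := hM (F.map (Function.Embedding.subtype _)) (by
      simp only [Finset.mem_map, Function.Embedding.subtype_apply]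
      rintro _ ⟨n, -, rfl⟩
      exact n.2)
    rw [Finset.sum_map] at this
    exact this

/-- The number of elements of `x` below `j`. -/
def countBelow (x : ℕ → Bool) (j : ℕ) : ℕ := ∑ k ∈ Finset.range j, (x k).toNat

/-- The set coding the pairs `(i, j)` such that `x` has exactly `i` elements below `j`. -/
def countGraph (x : ℕ → Bool) : Set ℕ := {n | countBelow x n.unpair.2 = n.unpair.1}

lemma countBelow_mono (x : ℕ → Bool) : Monotone (countBelow x) := fun _ _ h =>
  Finset.sum_le_sum_of_subset (Finset.range_mono h)

lemma continuous_chi_countGraph : Continuous fun x => chi (countGraph x) := by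
  refine continuous_pi fun n => ?_
  have : Continuous fun x => countBelow x n.unpair.2 :=
    continuous_finsetSum _ fun k _ =>
      (continuous_of_discreteTopology (f := Bool.toNat)).comp (continuous_apply k)
  exact (continuous_of_discreteTopology (f := fun m : ℕ => decide (m = n.unpair.1))).comp this
    |>.congr fun x => by
      rw [Bool.eq_iff_iff, chi_apply_eq_true]
      simp [countGraph]

lemma exists_lt_countBelow {x : ℕ → Bool} (hx : {n | x n = true}.Infinite) (N : ℕ) :
    ∃ j, N < countBelow x j := by
  induction N with
  | zero =>
    obtain ⟨n, hn⟩ := hx.nonempty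
    refine ⟨n + 1, ?_⟩
    rw [countBelow, Finset.sum_range_succ, show x n = true from hn]
    simp
  | succ N ih =>
    obtain ⟨j, hj⟩ := ih
    obtain ⟨n, hn, hjn⟩ := hx.exists_gt j
    refine ⟨n + 1, ?_⟩
    have := countBelow_mono x hjn.le
    rw [countBelow, Finset.sum_range_succ, show x n = true from hn, ← countBelow]
    simp
    omega

lemma finite_countGraph_of_infinite {x : ℕ → Bool} (hx : {n | x n = true}.Infinite) (N : ℕ) :
    {n ∈ countGraph x | n.unpair.1 ≤ N}.Finite := by
  obtain ⟨J, hJ⟩ := exists_lt_countBelow hx N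
  refine ((Finset.range (N + 1) ×ˢ Finset.range J).image
    fun p => Nat.pair p.1 p.2).finite_toSet.subset ?_
  rintro n ⟨hn, hnN⟩
  simp only [Finset.coe_image, Set.mem_image, Finset.mem_coe, Finset.mem_product, Finset.mem_range]
  refine ⟨n.unpair, ⟨by omega, ?_⟩, Nat.pair_unpair n⟩
  by_contra! h
  have := countBelow_mono x h
  have hn' : countBelow x n.unpair.2 = n.unpair.1 := hn
  omega

lemma infinite_countGraph_of_finite {x : ℕ → Bool} (hx : {n | x n = true}.Finite) :
    ∃ i, {n ∈ countGraph x | n.unpair.1 = i}.Infinite := by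
  obtain ⟨b, hb⟩ := hx.bddAbove
  have hconst : ∀ j, b < j → countBelow x j = countBelow x (b + 1) := fun j hj => by
    refine (Finset.sum_subset (Finset.range_mono hj) fun k _ hk => ?_).symm
    have : x k ≠ true := fun h => hk (Finset.mem_range.2 (Nat.lt_succ_of_le (hb h)))
    simp [this]
  refine ⟨countBelow x (b + 1), Set.infinite_of_injective_forall_mem
    (f := fun j => Nat.pair (countBelow x (b + 1)) (b + 1 + j)) (fun j k h => ?_) fun j => ?_⟩
  · have := (Nat.pair_eq_pair.1 h).2
    omega
  · simp [countGraph, hconst (b + 1 + j) (by omega)]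

lemma IsFsigma.preimage {S : Set (ℕ → Bool)} (hS : IsFsigma S) {g : (ℕ → Bool) → ℕ → Bool}
    (hg : Continuous g) : IsFsigma (g ⁻¹' S) := by
  obtain ⟨C, hC, rfl⟩ := hS
  exact ⟨_, fun n => (hC n).preimage hg, Set.preimage_iUnion⟩

/-- The infinite subsets of `ℕ` do not form an `F_σ` set. -/
lemma not_isFsigma_infinite : ¬ IsFsigma {x | {n | x n = true}.Infinite} := by
  classical
  rintro ⟨C, hC, hCu⟩
  let g : ℕ ⊕ Finset ℕ → Set (ℕ → Bool) := Sum.elim C fun F => {fun n => decide (n ∈ F)}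
  obtain ⟨i, x, hx⟩ := nonempty_interior_of_iUnion_of_closed (f := g)
    (by
      rintro (n | F)
      · exact hC n
      · exact isClosed_singleton)
    (by
      refine Set.eq_univ_of_forall fun x => ?_
      by_cases hx : {n | x n = true}.Infinite
      · have : x ∈ ⋃ n, C n := hCu ▸ hx
        obtain ⟨n, hn⟩ := Set.mem_iUnion.1 this
        exact Set.mem_iUnion.2 ⟨Sum.inl n, hn⟩
      · refine Set.mem_iUnion.2 ⟨Sum.inr (Set.not_infinite.1 hx).toFinset, ?_⟩
        ext n
        simp)
  rcases i with n | F
  · have hlim : Tendsto (fun m k => x k && decide (k < m)) atTop (𝓝 x) := by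
      refine tendsto_pi_nhds.2 fun k => tendsto_const_nhds.congr' ?_
      filter_upwards [eventually_gt_atTop k] with m hm
      simp [hm]
    obtain ⟨m, hm⟩ := (hlim.eventually (mem_interior_iff_mem_nhds.1 hx)).exists
    have : (fun k => x k && decide (k < m)) ∈ {x : ℕ → Bool | {n | x n = true}.Infinite} :=
      hCu ▸ Set.mem_iUnion.2 ⟨n, hm⟩
    refine this ((Set.finite_lt_nat m).subset fun k hk => ?_)
    simp only [Set.mem_ofPred_eq, Bool.and_eq_true, decide_eq_true_eq] at hk
    exact hk.2
  · have hlim : Tendsto (fun m => Function.update x m (!x m)) atTop (𝓝 x) := by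
      refine tendsto_pi_nhds.2 fun k => tendsto_const_nhds.congr' ?_
      filter_upwards [eventually_gt_atTop k] with m hm
      rw [Function.update_of_ne hm.ne]
    obtain ⟨m, hm⟩ := (hlim.eventually (mem_interior_iff_mem_nhds.1 hx)).exists
    have h1 := Set.mem_singleton_iff.1 (interior_subset hx)
    have h2 := Set.mem_singleton_iff.1 hm
    have := congrFun (h2.trans h1.symm) m
    simp at this

/-- The `n`-th unit vector of `c₀`. -/
noncomputable def c0Single (n : ℕ) : C₀(ℕ, ℝ) where
  toFun := Pi.single n (1 : ℝ)
  continuous_toFun := continuous_of_discreteTopology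
  zero_at_infty' := by
    rw [cocompact_eq_cofinite]
    refine tendsto_const_nhds.congr' ?_
    filter_upwards [(Set.finite_singleton n).compl_mem_cofinite] with k hk
    exact (Pi.single_eq_of_ne (M := fun _ => ℝ) hk 1).symm

lemma c0Single_apply (n k : ℕ) : c0Single n k = if k = n then 1 else 0 :=
  Pi.single_apply n (1 : ℝ) k

lemma one_le_norm_c0Single (n : ℕ) : 1 ≤ ‖c0Single n‖ := by
  simpa [c0Single_apply] using (c0Single n).norm_apply_le n

lemma norm_sum_c0Single_le (F : Finset ℕ) : ‖∑ n ∈ F, c0Single n‖ ≤ 1 := by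
  classical
  refine ZeroAtInftyContinuousMap.norm_le_of_forall zero_le_one fun k => ?_
  have : (∑ n ∈ F, c0Single n) k = ∑ n ∈ F, c0Single n k := by
    induction F using Finset.induction_on with
    | empty => simp
    | insert a s ha ih => simp [Finset.sum_insert ha, ih]
  rw [this]
  simp only [c0Single_apply, Finset.sum_ite_eq]
  split_ifs <;> simp

lemma summable_countGraph_iff {X : Type*} [NormedAddCommGroup X] [NormedSpace ℝ X]
    [CompleteSpace X] {z : ℕ → X} {M c : ℝ} (hc : 0 < c) (hz : ∀ n, c ≤ ‖z n‖)
    (hM : ∀ F : Finset ℕ, ‖∑ n ∈ F, z n‖ ≤ M) (x : ℕ → Bool) :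
    (Summable fun n : countGraph x => (1 / 2 : ℝ) ^ (n : ℕ).unpair.1 • z n) ↔
      {n | x n = true}.Infinite := by
  constructor
  · intro hs hx
    obtain ⟨i, hi⟩ := infinite_countGraph_of_finite hx
    have hev := hs.tendsto_cofinite_zero.norm.eventually
      (gt_mem_nhds (show ‖(0 : X)‖ < (1 / 2 : ℝ) ^ i * c by rw [norm_zero]; positivity))
    rw [eventually_cofinite] at hev
    refine hi ((hev.image Subtype.val).subset ?_)
    rintro n ⟨hn, hni⟩
    refine ⟨⟨n, hn⟩, ?_, rfl⟩
    simp only [Set.mem_ofPred_eq, not_lt, norm_smul, hni]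
    rw [Real.norm_of_nonneg (by positivity)]
    exact mul_le_mul_of_nonneg_left (hz n) (by positivity)
  · intro hx
    refine summable_smul_of_tendsto_zero (z := fun n : countGraph x => z n) (M := M)
      (fun F => by simpa using hM (F.map (Function.Embedding.subtype _)))
      (Tendsto.comp (tendsto_pow_atTop_nhds_zero_of_lt_one (by norm_num) (by norm_num)) ?_)
    refine tendsto_atTop.2 fun N => ?_
    rw [eventually_cofinite]
    refine Set.Finite.of_finite_image ((finite_countGraph_of_infinite hx N).subset ?_)
      Subtype.val_injective.injOn
    rintro _ ⟨n, hn, rfl⟩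
    exact ⟨n.2, (not_le.1 hn).le⟩

theorem stmt3
    (X : Type*) [NormedAddCommGroup X] [NormedSpace ℝ X] [CompleteSpace X] :
    (¬ ∃ (T : C₀(ℕ, ℝ) →L[ℝ] X) (c : ℝ), 0 < c ∧ ∀ x : C₀(ℕ, ℝ), c * ‖x‖ ≤ ‖T x‖) ↔
      ∀ h : ℕ → X, IsFsigma (chi '' {A : Set ℕ | Summable fun n : A => h n}) := by
  constructor
  · intro hX h
    refine isFsigma_of_forall_summable fun A ⟨M, hM⟩ => ?_
    by_contra hns
    obtain ⟨ε, hε, y, hy, hyM⟩ := exists_blocks_of_not_summable hM hns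
    exact hX (exists_c0_embedding_of_bounded_sums hε hy hyM)
  · rintro hF ⟨T, c, hc, hT⟩
    have hz : ∀ n, c ≤ ‖T (c0Single n)‖ := fun n =>
      (le_mul_of_one_le_right hc.le (one_le_norm_c0Single n)).trans (hT _)
    have hM : ∀ F : Finset ℕ, ‖∑ n ∈ F, T (c0Single n)‖ ≤ ‖T‖ := fun F => by
      rw [← map_sum]
      simpa using T.le_opNorm_of_le (norm_sum_c0Single_le F)
    have h := (hF fun n => (1 / 2 : ℝ) ^ n.unpair.1 • T (c0Single n)).preimage
      continuous_chi_countGraph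
    refine not_isFsigma_infinite ?_
    convert h using 1
    ext x
    rw [Set.mem_preimage, chi_injective.mem_set_image]
    exact (summable_countGraph_iff hc hz hM x).symm
end
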